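/- arXiv:1503.07376 — 4 statements merged into one kernel-verified Lean document; each statement's English description precedes it below -/
import Mathlib

section
/- Let P ∈ ℝⁿˣⁿ be symmetric with sym(PBᵢ) = 0 for i = 1,…,m, and let Q := −sym(PA). Let x and x⋆ be differentiable solutions of the bilinear system ẋ = Ax + d + Σᵢ uᵢBᵢx and of ẋ⋆ = Ax⋆ + d + Σᵢ u⋆ᵢBᵢx⋆ respectively, with x̃ := x − x⋆, ũ := u − u⋆, storage function V(x̃) := (1/2)x̃ᵀPx̃ and output y(t) := C(x⋆(t))x(t) where the i-th row of C(x⋆) is x⋆ᵀBᵢᵀP. Then for every t, (d/dt)V(x̃(t)) = −x̃(t)ᵀQx̃(t) + y(t)ᵀũ(t). -/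
open Matrix

/-- The symmetric part of a square real matrix: `sym M = (1/2)(M + Mᵀ)`. -/
noncomputable def sym {k : ℕ} (M : Matrix (Fin k) (Fin k) ℝ) : Matrix (Fin k) (Fin k) ℝ :=
  (1 / 2 : ℝ) • (M + Mᵀ)

theorem dotProduct_transpose_mulVec_comm {k : ℕ} (M : Matrix (Fin k) (Fin k) ℝ)
    (v w : Fin k → ℝ) : v ⬝ᵥ (Mᵀ *ᵥ w) = w ⬝ᵥ (M *ᵥ v) := by
  rw [mulVec_transpose, dotProduct_comm, ← dotProduct_mulVec]

theorem dotProduct_sym_mulVec {k : ℕ} (M : Matrix (Fin k) (Fin k) ℝ) (v w : Fin k → ℝ) :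
    v ⬝ᵥ (sym M *ᵥ w) = (1 / 2 : ℝ) * (v ⬝ᵥ (M *ᵥ w) + w ⬝ᵥ (M *ᵥ v)) := by
  rw [sym, smul_mulVec, dotProduct_smul, add_mulVec, dotProduct_add,
    dotProduct_transpose_mulVec_comm, smul_eq_mul]

theorem hasDerivAt_half_quadraticForm {k : ℕ} {P : Matrix (Fin k) (Fin k) ℝ} (hP : P.IsSymm)
    {e : ℝ → Fin k → ℝ} {e' : Fin k → ℝ} {t : ℝ} (he : HasDerivAt e e' t) :
    HasDerivAt (fun s => (1 / 2 : ℝ) * (e s ⬝ᵥ (P *ᵥ e s))) (e t ⬝ᵥ (P *ᵥ e')) t := by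
  have hc := hasDerivAt_pi.1 he
  have hPe (i : Fin k) : HasDerivAt (fun s => (P *ᵥ e s) i) ((P *ᵥ e') i) t := by
    simpa only [mulVec, dotProduct] using
      HasDerivAt.fun_sum (u := Finset.univ) fun j _ => (hc j).const_mul (P i j)
  have h : HasDerivAt (fun s => (1 / 2 : ℝ) * (e s ⬝ᵥ (P *ᵥ e s)))
      ((1 / 2 : ℝ) * ∑ i, (e' i * (P *ᵥ e t) i + e t i * (P *ᵥ e') i)) t :=
    (HasDerivAt.fun_sum fun i _ => (hc i).mul (hPe i)).const_mul _
  convert h using 1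
  have hsymm : e' ⬝ᵥ (P *ᵥ e t) = e t ⬝ᵥ (P *ᵥ e') := by
    simpa only [hP.eq] using dotProduct_transpose_mulVec_comm P e' (e t)
  rw [Finset.sum_add_distrib]
  change _ = (1 / 2 : ℝ) * (e' ⬝ᵥ (P *ᵥ e t) + e t ⬝ᵥ (P *ᵥ e'))
  rw [hsymm]
  ring

theorem dotProduct_mulVec_smul_sub_smul_of_sym_eq_zero {k : ℕ} {S : Matrix (Fin k) (Fin k) ℝ}
    (hS : sym S = 0) (v w : Fin k → ℝ) (a b : ℝ) :
    (v - w) ⬝ᵥ (a • (S *ᵥ v) - b • (S *ᵥ w)) = (v ⬝ᵥ (S *ᵥ w)) * (a - b) := by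
  have skew (p q : Fin k → ℝ) : p ⬝ᵥ (S *ᵥ q) + q ⬝ᵥ (S *ᵥ p) = 0 := by
    have h := dotProduct_sym_mulVec S p q
    rw [hS, zero_mulVec, dotProduct_zero] at h
    linarith
  simp only [sub_dotProduct, dotProduct_sub, dotProduct_smul, smul_eq_mul]
  linear_combination (a / 2) * skew v v + (b / 2) * skew w w - a * skew v w

/-- With `P` symmetric, `sym(P Bᵢ) = 0`, `Q := −sym(P A)`, for solutions
`x` of the bilinear system and `x⋆` of the reference dynamics, the storage function
`V(x̃) = (1/2) x̃ᵀ P x̃` satisfies `(d/dt) V(x̃(t)) = −x̃ᵀ Q x̃ + yᵀ ũ`, where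
`yᵢ = x⋆ᵀ Bᵢᵀ P x` and `ũ = u − u⋆`. -/
theorem stmt_2 {n m : ℕ}
    (A : Matrix (Fin n) (Fin n) ℝ) (B : Fin m → Matrix (Fin n) (Fin n) ℝ)
    (P : Matrix (Fin n) (Fin n) ℝ) (hP : P.IsSymm)
    (hPB : ∀ i, sym (P * B i) = 0)
    (d : ℝ → Fin n → ℝ)
    (x xs : ℝ → Fin n → ℝ) (u us : ℝ → Fin m → ℝ)
    (hx : ∀ t, HasDerivAt x (A *ᵥ x t + d t + ∑ i, u t i • (B i *ᵥ x t)) t)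
    (hxs : ∀ t, HasDerivAt xs (A *ᵥ xs t + d t + ∑ i, us t i • (B i *ᵥ xs t)) t)
    (y : ℝ → Fin m → ℝ)
    (hy : ∀ t i, y t i = xs t ⬝ᵥ ((B i)ᵀ *ᵥ (P *ᵥ x t))) :
    ∀ t, HasDerivAt (fun s => (1 / 2 : ℝ) * ((x s - xs s) ⬝ᵥ (P *ᵥ (x s - xs s))))
      (-((x t - xs t) ⬝ᵥ ((-sym (P * A)) *ᵥ (x t - xs t))) + y t ⬝ᵥ (u t - us t)) t := by
  intro t
  have he := (hx t).sub (hxs t)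
  have hsum : ∑ i, (x t - xs t) ⬝ᵥ (P *ᵥ (u t i • (B i *ᵥ x t) - us t i • (B i *ᵥ xs t))) =
      y t ⬝ᵥ (u t - us t) := by
    refine Finset.sum_congr rfl fun i _ => ?_
    rw [mulVec_sub, mulVec_smul, mulVec_smul, mulVec_mulVec, mulVec_mulVec,
      dotProduct_mulVec_smul_sub_smul_of_sym_eq_zero (hPB i), hy, Pi.sub_apply,
      ← dotProduct_transpose_mulVec_comm, transpose_mul, hP.eq, mulVec_mulVec]
  have hdyn : A *ᵥ x t + d t + ∑ i, u t i • (B i *ᵥ x t) -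
      (A *ᵥ xs t + d t + ∑ i, us t i • (B i *ᵥ xs t)) =
      A *ᵥ (x t - xs t) + ∑ i, (u t i • (B i *ᵥ x t) - us t i • (B i *ᵥ xs t)) := by
    rw [mulVec_sub, Finset.sum_sub_distrib]
    abel
  refine (hasDerivAt_half_quadraticForm hP he).congr_deriv ?_
  rw [hdyn, ← hsum, mulVec_add, mulVec_mulVec, dotProduct_add, mulVec_sum, dotProduct_sum,
    neg_mulVec, dotProduct_neg, neg_neg, dotProduct_sym_mulVec]
  simp only [Pi.sub_apply]
  ring
end

section
/- (Closed-loop Lyapunov identity) Consider the bilinear system ẋ = Ax + d + Σᵢ uᵢBᵢx under Assumption 1 with Q := −sym(PA), an admissible trajectory x⋆ with control u⋆, output y = C(x⋆)x, and the PI controller ż = −y, u = −K_p y + K_i z + u⋆ with K_p = K_pᵀ > 0, K_i = K_iᵀ > 0. Define W(x̃,z) := (1/2)x̃ᵀPx̃ + (1/2)zᵀK_i z. Then along any differentiable closed-loop solution, (d/dt)W(x̃(t),z(t)) = −x̃(t)ᵀQx̃(t) − y(t)ᵀK_p y(t) ≤ 0 for all t. -/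
open Matrix

theorem HasDerivAt.dotProduct_mulVec {k l : ℕ} {f : ℝ → Fin k → ℝ} {g : ℝ → Fin l → ℝ}
    {f' : Fin k → ℝ} {g' : Fin l → ℝ} {t : ℝ} (S : Matrix (Fin k) (Fin l) ℝ)
    (hf : HasDerivAt f f' t) (hg : HasDerivAt g g' t) :
    HasDerivAt (fun s => f s ⬝ᵥ (S *ᵥ g s)) (f' ⬝ᵥ (S *ᵥ g t) + f t ⬝ᵥ (S *ᵥ g')) t := by
  rw [hasDerivAt_pi] at hf hg
  simp only [dotProduct, mulVec, ← Finset.sum_add_distrib]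
  exact HasDerivAt.fun_sum fun i _ =>
    (hf i).fun_mul (HasDerivAt.fun_sum fun j _ => (hg j).const_mul (S i j))

theorem Matrix.dotProduct_mulVec_transpose {k l : ℕ} (S : Matrix (Fin k) (Fin l) ℝ)
    (v : Fin l → ℝ) (w : Fin k → ℝ) : v ⬝ᵥ (Sᵀ *ᵥ w) = w ⬝ᵥ (S *ᵥ v) := by
  rw [mulVec_transpose, dotProduct_comm, dotProduct_mulVec]

theorem Matrix.PosDef.dotProduct_mulVec_comm {k : ℕ} {S : Matrix (Fin k) (Fin k) ℝ}
    (hS : S.PosDef) (v w : Fin k → ℝ) : v ⬝ᵥ (S *ᵥ w) = w ⬝ᵥ (S *ᵥ v) := by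
  have hT : Sᵀ = S := by simpa using hS.isHermitian.eq
  rw [← dotProduct_mulVec_transpose, hT]

theorem HasDerivAt.half_quadratic {k : ℕ} {f : ℝ → Fin k → ℝ} {f' : Fin k → ℝ} {t : ℝ}
    {S : Matrix (Fin k) (Fin k) ℝ} (hS : S.PosDef) (hf : HasDerivAt f f' t) :
    HasDerivAt (fun s => (1 / 2 : ℝ) * (f s ⬝ᵥ (S *ᵥ f s))) (f t ⬝ᵥ (S *ᵥ f')) t := by
  refine ((hf.dotProduct_mulVec S hf).const_mul (1 / 2 : ℝ)).congr_deriv ?_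
  rw [hS.dotProduct_mulVec_comm f' (f t)]
  ring

theorem dotProduct_mulVec_antisymm {k : ℕ} {M : Matrix (Fin k) (Fin k) ℝ} (hM : sym M = 0)
    (v w : Fin k → ℝ) : v ⬝ᵥ (M *ᵥ w) = -(w ⬝ᵥ (M *ᵥ v)) := by
  have h := dotProduct_sym_mulVec M v w
  rw [hM, zero_mulVec, dotProduct_zero] at h
  linarith

/-- **closed-loop Lyapunov identity.** For the bilinear system under
Assumption 1 with `Q := −sym(P A)`, an admissible trajectory `x⋆` with control `u⋆`,
output `yᵢ = x⋆ᵀ Bᵢᵀ P x`, and the PI controller `ż = −y`, `u = −Kₚ y + Kᵢ z + u⋆`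
(`Kₚ, Kᵢ` symmetric positive definite), the function
`W(x̃, z) = (1/2) x̃ᵀ P x̃ + (1/2) zᵀ Kᵢ z` satisfies, along any differentiable
closed-loop solution, `(d/dt) W = −x̃ᵀ Q x̃ − yᵀ Kₚ y ≤ 0` for all `t`. -/
theorem stmt_6 {n m : ℕ}
    (A : Matrix (Fin n) (Fin n) ℝ) (B : Fin m → Matrix (Fin n) (Fin n) ℝ)
    (P : Matrix (Fin n) (Fin n) ℝ) (hP : P.PosDef)
    (hPA : (-sym (P * A)).PosSemidef)
    (hPB : ∀ i, sym (P * B i) = 0)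
    (d : ℝ → Fin n → ℝ)
    (x xs : ℝ → Fin n → ℝ) (u us : ℝ → Fin m → ℝ)
    (hxsb : ∃ M, ∀ t, ‖xs t‖ ≤ M) (husb : ∃ M, ∀ t, ‖us t‖ ≤ M)
    (Kp Ki : Matrix (Fin m) (Fin m) ℝ) (hKp : Kp.PosDef) (hKi : Ki.PosDef)
    (z : ℝ → Fin m → ℝ) (y : ℝ → Fin m → ℝ)
    (hy : ∀ t i, y t i = xs t ⬝ᵥ ((B i)ᵀ *ᵥ (P *ᵥ x t)))
    (hz : ∀ t, HasDerivAt z (-(y t)) t)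
    (hu : ∀ t, u t = -(Kp *ᵥ y t) + Ki *ᵥ z t + us t)
    (hx : ∀ t, HasDerivAt x (A *ᵥ x t + d t + ∑ i, u t i • (B i *ᵥ x t)) t)
    (hxs : ∀ t, HasDerivAt xs (A *ᵥ xs t + d t + ∑ i, us t i • (B i *ᵥ xs t)) t) :
    ∀ t, HasDerivAt
        (fun s => (1 / 2 : ℝ) * ((x s - xs s) ⬝ᵥ (P *ᵥ (x s - xs s)))
          + (1 / 2 : ℝ) * (z s ⬝ᵥ (Ki *ᵥ z s)))
        (-((x t - xs t) ⬝ᵥ ((-sym (P * A)) *ᵥ (x t - xs t))) - y t ⬝ᵥ (Kp *ᵥ y t)) t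
      ∧ -((x t - xs t) ⬝ᵥ ((-sym (P * A)) *ᵥ (x t - xs t))) - y t ⬝ᵥ (Kp *ᵥ y t) ≤ 0 := by
  intro t
  refine ⟨?_, ?_⟩
  · have hW := (((hx t).fun_sub (hxs t)).half_quadratic hP).fun_add ((hz t).half_quadratic hKi)
    refine hW.congr_deriv ?_
    have hy' : ∀ i, y t i = -(xs t ⬝ᵥ ((P * B i) *ᵥ x t)) := fun i => by
      rw [hy, dotProduct_mulVec_transpose, dotProduct_comm, hP.dotProduct_mulVec_comm, mulVec_mulVec,
        dotProduct_mulVec_antisymm (hPB i)]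
    have hskew : ∀ i (v : Fin n → ℝ), v ⬝ᵥ ((P * B i) *ᵥ v) = 0 := fun i v => by
      linarith [dotProduct_mulVec_antisymm (hPB i) v v]
    have hterm : ∀ i, (x t - xs t) ⬝ᵥ (P *ᵥ (u t i • (B i *ᵥ x t)))
        - (x t - xs t) ⬝ᵥ (P *ᵥ (us t i • (B i *ᵥ xs t))) = y t i * (u t i - us t i) := fun i => by
      have h := dotProduct_mulVec_antisymm (hPB i) (x t) (xs t)
      simp only [mulVec_smul, mulVec_mulVec, dotProduct_smul, sub_dotProduct, smul_eq_mul,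
        hskew, hy' i, h]
      ring
    have hsum : (x t - xs t) ⬝ᵥ (P *ᵥ ∑ i, u t i • (B i *ᵥ x t))
        - (x t - xs t) ⬝ᵥ (P *ᵥ ∑ i, us t i • (B i *ᵥ xs t)) = y t ⬝ᵥ (u t - us t) := by
      simp only [mulVec_sum, dotProduct_sum, ← Finset.sum_sub_distrib, hterm]
      rfl
    have hu' : u t - us t = -(Kp *ᵥ y t) + Ki *ᵥ z t := by rw [hu]; abel
    rw [hu', dotProduct_add, dotProduct_neg, hKi.dotProduct_mulVec_comm] at hsum
    have hdrift : A *ᵥ x t + d t + ∑ i, u t i • (B i *ᵥ x t)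
        - (A *ᵥ xs t + d t + ∑ i, us t i • (B i *ᵥ xs t))
        = A *ᵥ (x t - xs t) + (∑ i, u t i • (B i *ᵥ x t) - ∑ i, us t i • (B i *ᵥ xs t)) := by
      rw [mulVec_sub]; abel
    rw [hdrift, mulVec_add, mulVec_sub P, dotProduct_add, dotProduct_sub, hsum, mulVec_mulVec,
      neg_mulVec, dotProduct_neg, dotProduct_sym_mulVec, mulVec_neg, dotProduct_neg]
    ring
  · have hQ := hPA.dotProduct_mulVec_nonneg (x t - xs t)
    have hK := hKp.posSemidef.dotProduct_mulVec_nonneg (y t)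
    simp only [star_trivial] at hQ hK
    linarith
end

section
/- (Stability of the hyperbolic-tangent-modified PI controller for the boost converter) Under Assumption 1 for the boost system (P = diag(L/2, C), Q = diag(0, 1/R)) with admissible trajectory x⋆ and scalar passive output y = x⋆₁x₂ − x⋆₂x₁, consider the modified controller ż = −y, u = −b·tanh(y/a) + K_i z + u⋆ with a, b, K_i > 0. Then along any differentiable closed-loop solution, W(x̃,z) := (1/2)x̃ᵀPx̃ + (1/2)K_i z² satisfies (d/dt)W = −x̃ᵀQx̃ − b·y·tanh(y/a) ≤ 0 for all t, since y·tanh(y/a) ≥ 0 for every y ∈ ℝ. -/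
open Matrix

theorem mul_tanh_div_nonneg {a : ℝ} (ha : 0 < a) (s : ℝ) : 0 ≤ s * Real.tanh (s / a) := by
  rw [Real.tanh_eq_sinh_div_cosh, ← mul_div_assoc]
  refine div_nonneg ?_ (Real.cosh_pos _).le
  rcases le_total 0 s with hs | hs
  · exact mul_nonneg hs (Real.sinh_nonneg_iff.2 (div_nonneg hs ha.le))
  · exact mul_nonneg_of_nonpos_of_nonpos hs
      (Real.sinh_nonpos_iff.2 (div_nonpos_of_nonpos_of_nonneg hs ha.le))

/-- Derivative of a diagonal quadratic energy `(p e₀² + q e₁² + k z²) / 2`. -/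
theorem hasDerivAt_diagonal_energy {x₀ x₁ z : ℝ → ℝ} {x₀' x₁' z' t : ℝ} (p q k : ℝ)
    (h₀ : HasDerivAt x₀ x₀' t) (h₁ : HasDerivAt x₁ x₁' t) (hz : HasDerivAt z z' t) :
    HasDerivAt (fun s => (1 / 2 : ℝ) * (x₀ s * (p * x₀ s) + x₁ s * (q * x₁ s))
        + (1 / 2 : ℝ) * k * z s ^ 2)
      (p * x₀ t * x₀' + q * x₁ t * x₁' + k * z t * z') t := by
  refine ((((h₀.mul (h₀.const_mul p)).add (h₁.mul (h₁.const_mul q))).const_mul (1 / 2)).add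
    ((hz.pow 2).const_mul (1 / 2 * k))).congr_deriv ?_
  norm_num
  ring

/-- **stability of the tanh-modified PI controller for the boost
converter.** For the boost system (satisfying Assumption 1 with `P = diag(L/2, C)`,
`Q = diag(0, 1/R)`), an admissible trajectory `x⋆`, scalar passive output
`y = x⋆₁ x₂ − x⋆₂ x₁`, and the modified controller `ż = −y`,
`u = −b·tanh(y/a) + Kᵢ z + u⋆` with `a, b, Kᵢ > 0`: along any differentiable closed-loop
solution, `W(x̃, z) = (1/2) x̃ᵀ P x̃ + (1/2) Kᵢ z²` satisfies
`(d/dt) W = −x̃ᵀ Q x̃ − b·y·tanh(y/a) ≤ 0`, since `y·tanh(y/a) ≥ 0` for every `y ∈ ℝ`. -/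
theorem stmt_16 (L C R E a b Ki : ℝ)
    (hL : 0 < L) (hC : 0 < C) (hR : 0 < R)
    (ha : 0 < a) (hb : 0 < b) (hKi : 0 < Ki)
    (x xs : ℝ → Fin 2 → ℝ) (u us : ℝ → ℝ) (z y : ℝ → ℝ)
    (hy : ∀ t, y t = xs t 0 * x t 1 - xs t 1 * x t 0)
    (hxsb : ∃ M, ∀ t, ‖xs t‖ ≤ M) (husb : ∃ M, ∀ t, |us t| ≤ M)
    (hx : ∀ t, HasDerivAt x
      ((!![0, 0; 0, -(1 / (R * C))] : Matrix (Fin 2) (Fin 2) ℝ) *ᵥ x t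
        + ![2 * E / L, 0]
        + u t • ((!![0, -(2 / L); 1 / C, 0] : Matrix (Fin 2) (Fin 2) ℝ) *ᵥ x t)) t)
    (hxs : ∀ t, HasDerivAt xs
      ((!![0, 0; 0, -(1 / (R * C))] : Matrix (Fin 2) (Fin 2) ℝ) *ᵥ xs t
        + ![2 * E / L, 0]
        + us t • ((!![0, -(2 / L); 1 / C, 0] : Matrix (Fin 2) (Fin 2) ℝ) *ᵥ xs t)) t)
    (hz : ∀ t, HasDerivAt z (-(y t)) t)
    (hu : ∀ t, u t = -(b * Real.tanh (y t / a)) + Ki * z t + us t) :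
    (∀ s : ℝ, 0 ≤ s * Real.tanh (s / a)) ∧
    ∀ t, HasDerivAt
        (fun s => (1 / 2 : ℝ) * ((x s - xs s) ⬝ᵥ
            ((!![L / 2, 0; 0, C] : Matrix (Fin 2) (Fin 2) ℝ) *ᵥ (x s - xs s)))
          + (1 / 2 : ℝ) * Ki * (z s) ^ 2)
        (-((x t - xs t) ⬝ᵥ
            ((!![0, 0; 0, 1 / R] : Matrix (Fin 2) (Fin 2) ℝ) *ᵥ (x t - xs t)))
          - b * y t * Real.tanh (y t / a)) t
      ∧ -((x t - xs t) ⬝ᵥ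
            ((!![0, 0; 0, 1 / R] : Matrix (Fin 2) (Fin 2) ℝ) *ᵥ (x t - xs t)))
          - b * y t * Real.tanh (y t / a) ≤ 0 := by
  refine ⟨mul_tanh_div_nonneg ha, fun t => ⟨?_, ?_⟩⟩
  · have he := hasDerivAt_pi.1 ((hx t).sub (hxs t))
    have h := hasDerivAt_diagonal_energy (L / 2) C Ki (he 0) (he 1) (hz t)
    simp only [mulVec, dotProduct, Fin.sum_univ_two, Pi.sub_apply, Pi.add_apply, Pi.smul_apply,
      smul_eq_mul, of_apply, cons_val_zero, cons_val_one, zero_mul, zero_add,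
      add_zero] at h ⊢
    refine h.congr_deriv ?_
    rw [hu t, hy t]
    field_simp
    ring
  · have h := mul_nonneg hb.le (mul_tanh_div_nonneg ha (y t))
    have hQ : 0 ≤ 1 / R * (x t 1 - xs t 1) ^ 2 := by positivity
    simp only [mulVec, dotProduct, Fin.sum_univ_two, Pi.sub_apply, of_apply, cons_val_zero,
      cons_val_one, zero_mul, zero_add, mul_zero]
    linarith
end

section
/- (MMC rank condition) Let R, R′ > 0 and x⋆ = (x⋆₁, x⋆₂, x⋆₃, x⋆₄) ∈ ℝ⁴. Consider the 6×4 matrix whose rows are (−(1/2)x⋆₃, −(1/4)x⋆₄, (1/2)x⋆₁, (1/4)x⋆₂), (−(1/2)x⋆₄, −(1/4)x⋆₃, (1/4)x⋆₂, (1/2)x⋆₁), (√(2R), 0, 0, 0), (0, √(R′), 0, 0), (0,0,0,0), (0,0,0,0). If x⋆₁² − (1/4)x⋆₂² ≠ 0, then this matrix has rank 4. -/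
open Matrix

/-- **MMC rank condition.** For `R, R′ > 0` and
`x⋆ = (x⋆₁, x⋆₂, x⋆₃, x⋆₄) ∈ ℝ⁴`, if `x⋆₁² − (1/4) x⋆₂² ≠ 0`, then the `6 × 4` matrix
with rows `(−(1/2)x⋆₃, −(1/4)x⋆₄, (1/2)x⋆₁, (1/4)x⋆₂)`,
`(−(1/2)x⋆₄, −(1/4)x⋆₃, (1/4)x⋆₂, (1/2)x⋆₁)`, `(√(2R), 0, 0, 0)`, `(0, √R′, 0, 0)`,
`(0,0,0,0)`, `(0,0,0,0)` has rank `4`. -/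
theorem stmt_18 (R Rp : ℝ) (hR : 0 < R) (hRp : 0 < Rp)
    (xs1 xs2 xs3 xs4 : ℝ) (h : xs1 ^ 2 - (1 / 4) * xs2 ^ 2 ≠ 0) :
    (!![-(1 / 2) * xs3, -(1 / 4) * xs4, (1 / 2) * xs1, (1 / 4) * xs2;
        -(1 / 2) * xs4, -(1 / 4) * xs3, (1 / 4) * xs2, (1 / 2) * xs1;
        Real.sqrt (2 * R), 0, 0, 0;
        0, Real.sqrt Rp, 0, 0;
        0, 0, 0, 0;
        0, 0, 0, 0] : Matrix (Fin 6) (Fin 4) ℝ).rank = 4 := by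
  have hR' : Real.sqrt R ≠ 0 := (Real.sqrt_pos.2 hR).ne'
  have hRp' : Real.sqrt Rp ≠ 0 := (Real.sqrt_pos.2 hRp).ne'
  rw [Matrix.rank, LinearMap.finrank_range_of_inj, Module.finrank_fin_fun]
  rw [injective_iff_map_eq_zero]
  intro v hv
  have e0 := congrFun hv 0
  have e1 := congrFun hv 1
  have e2 := congrFun hv 2
  have e3 := congrFun hv 3
  simp [Matrix.mulVec, dotProduct, Fin.sum_univ_four, hR'] at e2
  simp [Matrix.mulVec, dotProduct, Fin.sum_univ_four, hRp'] at e3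
  simp [Matrix.mulVec, dotProduct, Fin.sum_univ_four, e2, e3] at e0 e1
  have h2 : v 2 = 0 :=
    (mul_eq_zero.1 (by linear_combination 2 * xs1 * e0 - xs2 * e1 :
      (xs1 ^ 2 - (1 / 4) * xs2 ^ 2) * v 2 = 0)).resolve_left h
  have h3 : v 3 = 0 :=
    (mul_eq_zero.1 (by linear_combination 2 * xs1 * e1 - xs2 * e0 :
      (xs1 ^ 2 - (1 / 4) * xs2 ^ 2) * v 3 = 0)).resolve_left h
  ext i
  fin_cases i <;> simp [e2, e3, h2, h3]
end
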